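/- Let V be a finite or countable set, (V,E) a connected digraph (every ordered pair of vertices is joined by a directed path), w : E → [0,∞) a weight function, and let the cost c : V×V → [0,∞) be defined by c(x,y) = inf over directed paths γ from x to y of ∑_{e∈γ} w(e). Then for all probability measures μ₁, μ₂ on V: inf_ρ E_ρ(c) = inf_Q ⟨Q,w⟩_E, where the left infimum runs over all couplings ρ of μ₁ and μ₂, the right infimum runs over all finitely decomposable flows Q on (V,E) with div Q = μ₁ − μ₂, and ⟨Q,w⟩_E = ∑_{(x,y)∈E} Q(x,y)w(x,y). -/

import Mathlib

open scoped BigOperators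

variable {V : Type*}

/-- A directed path in the digraph `(V, E)`: a nonempty list of vertices whose
consecutive pairs are directed edges. -/
def IsDipath (E : Set (V × V)) (l : List V) : Prop :=
  l ≠ [] ∧ l.Chain' (fun a b => (a, b) ∈ E)

/-- The list of directed edges of a path. -/
def pathEdges (l : List V) : List (V × V) := l.zip l.tail

/-- The unit flow `Q_γ` along a path: `1` on the edges of the path and `0` elsewhere. -/
noncomputable def pathFlow (l : List V) : V × V → ℝ :=
  Set.indicator {e | e ∈ pathEdges l} 1

/-- A flow on the digraph `(V, E)`: nonnegative and supported on `E`. -/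
def IsFlow (E : Set (V × V)) (Q : V × V → ℝ) : Prop :=
  (∀ e, 0 ≤ Q e) ∧ ∀ e, e ∉ E → Q e = 0

/-- The divergence of a flow at a vertex. -/
noncomputable def divergence (Q : V × V → ℝ) (x : V) : ℝ :=
  (∑' y, Q (x, y)) - ∑' y, Q (y, x)

/-- A relation is acyclic if it has no directed cycles. -/
def AcyclicRel (r : V → V → Prop) : Prop := ∀ x, ¬ Relation.TransGen r x x

/-- The edge relation of a digraph. -/
def edgeRel (E : Set (V × V)) : V → V → Prop := fun a b => (a, b) ∈ E

/-- The partial order induced by an acyclic digraph: `x ≤ y` iff `x = y` or there is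
a directed path from `x` to `y`. -/
def inducedLE (E : Set (V × V)) : V → V → Prop :=
  Relation.ReflTransGen (edgeRel E)

/-- A finitely decomposable flow: a pointwise sum `∑ₙ qₙ Q_{γₙ}` over finite
self-avoiding directed paths with summable nonnegative weights. -/
def FinDecomposable (E : Set (V × V)) (Q : V × V → ℝ) : Prop :=
  ∃ (γ : ℕ → List V) (q : ℕ → ℝ),
    (∀ n, IsDipath E (γ n)) ∧ (∀ n, (γ n).Nodup) ∧ (∀ n, 0 ≤ q n) ∧ Summable q ∧
    ∀ e, Q e = ∑' n, q n * pathFlow (γ n) e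

/-- A probability measure on a countable set, as a nonnegative function of total sum `1`. -/
def IsProb (μ : V → ℝ) : Prop := (∀ x, 0 ≤ μ x) ∧ HasSum μ 1

/-- A coupling of `μ₁` and `μ₂`: a probability on `V × V` with the given marginals. -/
def IsCoupling (μ₁ μ₂ : V → ℝ) (ρ : V × V → ℝ) : Prop :=
  (∀ p, 0 ≤ ρ p) ∧ (∀ x, HasSum (fun y => ρ (x, y)) (μ₁ x)) ∧
    ∀ y, HasSum (fun x => ρ (x, y)) (μ₂ y)

/-- Stochastic domination: `∑ f μ₁ ≤ ∑ f μ₂` for every bounded increasing `f`. -/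
def StochDom (le : V → V → Prop) (μ₁ μ₂ : V → ℝ) : Prop :=
  ∀ f : V → ℝ, (∃ C, ∀ x, |f x| ≤ C) → (∀ x y, le x y → f x ≤ f y) →
    ∑' x, f x * μ₁ x ≤ ∑' x, f x * μ₂ x

/-- Finite-case divergence. -/
noncomputable def divergenceF [Fintype V] (Q : V × V → ℝ) (x : V) : ℝ :=
  (∑ y, Q (x, y)) - ∑ y, Q (y, x)

/-- Probability measure on a finite set. -/
def IsProbF [Fintype V] (μ : V → ℝ) : Prop := (∀ x, 0 ≤ μ x) ∧ ∑ x, μ x = 1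

/-- Coupling on a finite set. -/
def IsCouplingF [Fintype V] (μ₁ μ₂ : V → ℝ) (ρ : V × V → ℝ) : Prop :=
  (∀ p, 0 ≤ ρ p) ∧ (∀ x, ∑ y, ρ (x, y) = μ₁ x) ∧ ∀ y, ∑ x, ρ (x, y) = μ₂ y

/-- Stochastic domination on a finite set. -/
def StochDomF [Fintype V] (le : V → V → Prop) (μ₁ μ₂ : V → ℝ) : Prop :=
  ∀ f : V → ℝ, (∀ x y, le x y → f x ≤ f y) → ∑ x, f x * μ₁ x ≤ ∑ x, f x * μ₂ x

/-- The cost of a path: the sum of the weights of its edges. -/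
noncomputable def pathCost (w : V × V → ℝ) (l : List V) : ℝ := ((pathEdges l).map w).sum

/-- The geodesic cost associated to a weight function on a digraph. -/
noncomputable def geoCost (E : Set (V × V)) (w : V × V → ℝ) (x y : V) : ℝ :=
  sInf {r | ∃ l, IsDipath E l ∧ l.head? = some x ∧ l.getLast? = some y ∧ pathCost w l = r}

open scoped ENNReal

section StoppedChain

open Filter Topology

open scoped Classical in
/-- The joint law of the starting point and the position at time `k` of the (killed) Markov
chain with initial measure `μ` and sub-Markovian kernel `K`. -/
noncomputable def chainLaw (μ : V → ℝ≥0∞) (K : V → V → ℝ≥0∞) : ℕ → V → V → ℝ≥0∞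
  | 0 => fun x y => if x = y then μ x else 0
  | k + 1 => fun x z => ∑' y, chainLaw μ K k x y * K y z

variable {μ ν σ : V → ℝ≥0∞} {K S : V → V → ℝ≥0∞} {c : V → V → ℝ≥0∞}

theorem tsum_chainLaw_zero_row (x : V) : ∑' y, chainLaw μ K 0 x y = μ x := by
  classical
  simp only [chainLaw]
  rw [tsum_eq_single x (fun y hy => if_neg (Ne.symm hy)), if_pos rfl]

theorem tsum_chainLaw_zero_col (y : V) : ∑' x, chainLaw μ K 0 x y = μ y := by
  classical
  simp only [chainLaw]
  rw [tsum_eq_single y (fun x hx => if_neg hx), if_pos rfl]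

theorem tsum_chainLaw_succ_col (k : ℕ) (z : V) :
    ∑' x, chainLaw μ K (k + 1) x z = ∑' y, (∑' x, chainLaw μ K k x y) * K y z := by
  simp only [chainLaw]
  rw [ENNReal.tsum_comm]
  simp only [ENNReal.tsum_mul_right]

theorem tsum_chainLaw_col_le (hK : ∀ y, ∑' x, (μ x + σ x) * K x y = σ y) (y : V) :
    ∑' k, ∑' x, chainLaw μ K k x y ≤ μ y + σ y := by
  refine ENNReal.tsum_le_of_sum_range_le fun n => ?_
  induction n generalizing y with
  | zero => simp
  | succ n ih =>
    rw [Finset.sum_range_succ', tsum_chainLaw_zero_col, add_comm]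
    gcongr
    simp only [tsum_chainLaw_succ_col]
    rw [← Summable.tsum_finsetSum (fun _ _ => ENNReal.summable), ← hK y]
    refine ENNReal.tsum_le_tsum fun x => ?_
    rw [← Finset.sum_mul]
    gcongr
    exact ih x

theorem tsum_chainLaw_row_eq (hKS : ∀ x, ∑' y, (K x y + S x y) = 1) (k : ℕ) (x : V) :
    ∑' y, chainLaw μ K k x y =
      (∑' z, ∑' y, chainLaw μ K k x y * S y z) + ∑' y, chainLaw μ K (k + 1) x y := by
  simp only [chainLaw]
  rw [← ENNReal.tsum_add]
  simp only [← ENNReal.tsum_add, ← mul_add]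
  rw [ENNReal.tsum_comm]
  simp only [ENNReal.tsum_mul_left, add_comm (S _ _), hKS, mul_one]

theorem sum_stopped_add_chainLaw_row (hKS : ∀ x, ∑' y, (K x y + S x y) = 1) (n : ℕ) (x : V) :
    (∑ k ∈ Finset.range n, ∑' z, ∑' y, chainLaw μ K k x y * S y z) +
      ∑' y, chainLaw μ K n x y = μ x := by
  induction n with
  | zero => simpa using tsum_chainLaw_zero_row x
  | succ n ih => rw [Finset.sum_range_succ, add_assoc, ← tsum_chainLaw_row_eq hKS, ih]

/-- The joint law of the starting point and the stopping point of a chain that moves by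
`K + S`, the steps made by `S` being the final ones. -/
noncomputable def stoppedLaw (μ : V → ℝ≥0∞) (K S : V → V → ℝ≥0∞) (x z : V) : ℝ≥0∞ :=
  ∑' k, ∑' y, chainLaw μ K k x y * S y z

theorem tsum_stoppedLaw_row (hKS : ∀ x, ∑' y, (K x y + S x y) = 1)
    (hK : ∀ y, ∑' x, (μ x + σ x) * K x y = σ y) (hfin : ∑' x, (μ x + σ x) ≠ ⊤) (x : V) :
    ∑' z, stoppedLaw μ K S x z = μ x := by
  have hsum : ∑' k, ∑' y, chainLaw μ K k x y ≠ ⊤ := by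
    refine ne_top_of_le_ne_top hfin ?_
    rw [ENNReal.tsum_comm]
    refine ENNReal.tsum_le_tsum fun y => le_trans ?_ (tsum_chainLaw_col_le hK y)
    exact ENNReal.tsum_le_tsum fun k => ENNReal.le_tsum x
  have h0 := ENNReal.tendsto_atTop_zero_of_tsum_ne_top hsum
  have h1 := (ENNReal.tendsto_nat_tsum
    fun k => ∑' z, ∑' y, chainLaw μ K k x y * S y z).add h0
  simp only [sum_stopped_add_chainLaw_row hKS, add_zero] at h1
  simp only [stoppedLaw]
  rw [ENNReal.tsum_comm]
  exact tendsto_nhds_unique h1 tendsto_const_nhds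

theorem tsum_stoppedLaw_col_le (hK : ∀ y, ∑' x, (μ x + σ x) * K x y = σ y)
    (hS : ∀ y, ∑' x, (μ x + σ x) * S x y = ν y) (z : V) :
    ∑' x, stoppedLaw μ K S x z ≤ ν z := by
  simp only [stoppedLaw]
  rw [ENNReal.tsum_comm]
  calc ∑' k, ∑' x, ∑' y, chainLaw μ K k x y * S y z
      = ∑' y, (∑' k, ∑' x, chainLaw μ K k x y) * S y z := by
        simp only [← ENNReal.tsum_mul_right]
        rw [ENNReal.tsum_comm (α := V) (β := ℕ)]
        refine tsum_congr fun k => ?_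
        rw [ENNReal.tsum_comm]
    _ ≤ ∑' y, (μ y + σ y) * S y z := by
        gcongr with y
        exact tsum_chainLaw_col_le hK y
    _ = ν z := hS z

theorem stopped_cost_step (hKS : ∀ x, ∑' y, (K x y + S x y) = 1)
    (htri : ∀ x y z, c x z ≤ c x y + c y z) (k : ℕ) :
    (∑' x, ∑' z, (∑' y, chainLaw μ K k x y * S y z) * c x z) +
        ∑' x, ∑' z, chainLaw μ K (k + 1) x z * c x z ≤
      (∑' x, ∑' y, chainLaw μ K k x y * c x y) +
        ∑' y, ∑' z, (∑' x, chainLaw μ K k x y) * (K y z + S y z) * c y z := by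
  have h2 : ∑' y, ∑' z, (∑' x, chainLaw μ K k x y) * (K y z + S y z) * c y z =
      ∑' x, ∑' y, ∑' z, chainLaw μ K k x y * (K y z + S y z) * c y z := by
    rw [ENNReal.tsum_comm (α := V) (β := V)
      (f := fun x y => ∑' z, chainLaw μ K k x y * (K y z + S y z) * c y z)]
    refine tsum_congr fun y => ?_
    rw [ENNReal.tsum_comm]
    simp only [ENNReal.tsum_mul_right]
  rw [h2, ← ENNReal.tsum_add, ← ENNReal.tsum_add]
  refine ENNReal.tsum_le_tsum fun x => ?_
  simp only [chainLaw]
  rw [← ENNReal.tsum_add, ← ENNReal.tsum_add]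
  calc ∑' z, ((∑' y, chainLaw μ K k x y * S y z) * c x z +
        (∑' y, chainLaw μ K k x y * K y z) * c x z)
      = ∑' y, ∑' z, chainLaw μ K k x y * (K y z + S y z) * c x z := by
        rw [ENNReal.tsum_comm]
        refine tsum_congr fun z => ?_
        rw [← add_mul, ← ENNReal.tsum_add, ← ENNReal.tsum_mul_right]
        refine tsum_congr fun y => ?_
        ring
    _ ≤ ∑' y, ∑' z, (chainLaw μ K k x y * (K y z + S y z) * c x y +
          chainLaw μ K k x y * (K y z + S y z) * c y z) := by
        gcongr with y z
        rw [← mul_add]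
        gcongr
        exact htri x y z
    _ = _ := by
        refine tsum_congr fun y => ?_
        rw [ENNReal.tsum_add, ENNReal.tsum_mul_right, ENNReal.tsum_mul_left, hKS, mul_one]

theorem tsum_stoppedLaw_mul_le (hKS : ∀ x, ∑' y, (K x y + S x y) = 1)
    (hK : ∀ y, ∑' x, (μ x + σ x) * K x y = σ y)
    (hc : ∀ x, c x x = 0) (htri : ∀ x y z, c x z ≤ c x y + c y z) :
    ∑' x, ∑' z, stoppedLaw μ K S x z * c x z ≤
      ∑' x, ∑' y, (μ x + σ x) * (K x y + S x y) * c x y := by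
  have hstep (n : ℕ) :
      (∑ k ∈ Finset.range n, ∑' x, ∑' z, (∑' y, chainLaw μ K k x y * S y z) * c x z) +
        ∑' x, ∑' z, chainLaw μ K n x z * c x z ≤
      ∑ k ∈ Finset.range n,
        ∑' y, ∑' z, (∑' x, chainLaw μ K k x y) * (K y z + S y z) * c y z := by
    induction n with
    | zero =>
      simp only [Finset.range_zero, Finset.sum_empty, zero_add, nonpos_iff_eq_zero,
        ENNReal.tsum_eq_zero, chainLaw]
      intro x y
      split_ifs with h
      · rw [h, hc, mul_zero]
      · rw [zero_mul]
    | succ n ih =>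
      rw [Finset.sum_range_succ, Finset.sum_range_succ, add_assoc]
      refine (add_le_add_right (stopped_cost_step hKS htri n) _).trans ?_
      rw [← add_assoc]
      exact add_le_add_left ih _
  calc ∑' x, ∑' z, stoppedLaw μ K S x z * c x z
      = ∑' k, ∑' x, ∑' z, (∑' y, chainLaw μ K k x y * S y z) * c x z := by
        simp only [stoppedLaw, ← ENNReal.tsum_mul_right (α := ℕ)]
        rw [ENNReal.tsum_comm (α := ℕ) (β := V)]
        refine tsum_congr fun x => ?_
        rw [ENNReal.tsum_comm]
    _ ≤ ∑' k, ∑' y, ∑' z, (∑' x, chainLaw μ K k x y) * (K y z + S y z) * c y z :=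
        ENNReal.tsum_le_of_sum_range_le fun n =>
          (le_self_add.trans (hstep n)).trans (ENNReal.sum_le_tsum _)
    _ = ∑' y, ∑' z, (∑' k, ∑' x, chainLaw μ K k x y) * (K y z + S y z) * c y z := by
        simp only [← ENNReal.tsum_mul_right (α := ℕ)]
        rw [ENNReal.tsum_comm (α := ℕ) (β := V)]
        refine tsum_congr fun x => ?_
        rw [ENNReal.tsum_comm]
    _ ≤ _ := by
        gcongr with y z
        exact tsum_chainLaw_col_le hK y

/-- For a cost satisfying the triangle inequality and vanishing on the diagonal, a common part
`σ` can be removed from both marginals of a transport plan without increasing its cost. -/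
theorem exists_coupling_of_common_part {π : V → V → ℝ≥0∞}
    (hμ : ∑' x, μ x = 1) (hν : ∑' x, ν x = 1) (hσ : ∑' x, σ x ≠ ⊤)
    (hrow : ∀ x, ∑' y, π x y = μ x + σ x) (hcol : ∀ y, ∑' x, π x y = ν y + σ y)
    (hc : ∀ x, c x x = 0) (htri : ∀ x y z, c x z ≤ c x y + c y z) :
    ∃ ρ : V → V → ℝ≥0∞, (∀ x, ∑' y, ρ x y = μ x) ∧ (∀ y, ∑' x, ρ x y = ν y) ∧
      ∑' x, ∑' y, ρ x y * c x y ≤ ∑' x, ∑' y, π x y * c x y := by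
  classical
  have hfin : ∑' x, (μ x + σ x) ≠ ⊤ := by
    rw [ENNReal.tsum_add, hμ]
    exact ENNReal.add_ne_top.2 ⟨ENNReal.one_ne_top, hσ⟩
  have hfin' : ∑' x, (ν x + σ x) ≠ ⊤ := by
    rw [ENNReal.tsum_add, hν]
    exact ENNReal.add_ne_top.2 ⟨ENNReal.one_ne_top, hσ⟩
  have hμσ := ENNReal.ne_top_of_tsum_ne_top hfin
  have hνσ := ENNReal.ne_top_of_tsum_ne_top hfin'
  set P : V → V → ℝ≥0∞ := fun x y =>
    if μ x + σ x = 0 then (if x = y then 1 else 0) else π x y / (μ x + σ x) with hP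
  have hPsum (x : V) : ∑' y, P x y = 1 := by
    simp only [hP]
    split_ifs with h
    · simp
    · simp only [div_eq_mul_inv]
      rw [ENNReal.tsum_mul_right, hrow]
      exact ENNReal.mul_inv_cancel h (hμσ x)
  have hPmul (x y : V) : (μ x + σ x) * P x y = π x y := by
    by_cases h : μ x + σ x = 0
    · rw [h, zero_mul]
      exact (ENNReal.tsum_eq_zero.1 ((hrow x).trans h) y).symm
    · simp only [hP, if_neg h]
      exact ENNReal.mul_div_cancel h (hμσ x)
  set θ : V → ℝ≥0∞ := fun y => σ y / (ν y + σ y) with hθ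
  set η : V → ℝ≥0∞ := fun y => 1 - θ y with hη
  have hθη (y : V) : θ y + η y = 1 :=
    add_tsub_cancel_of_le (ENNReal.div_le_of_le_mul (by rw [one_mul]; exact le_add_self))
  have hθmul (y : V) : (ν y + σ y) * θ y = σ y := by
    by_cases h : ν y + σ y = 0
    · rw [h, zero_mul, (add_eq_zero.1 h).2]
    · exact ENNReal.mul_div_cancel h (hνσ y)
  have hηmul (y : V) : (ν y + σ y) * η y = ν y := by
    have h : (ν y + σ y) * θ y + (ν y + σ y) * η y = ν y + σ y := by
      rw [← mul_add, hθη, mul_one]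
    rw [hθmul, add_comm] at h
    exact (ENNReal.add_left_inj (ENNReal.ne_top_of_tsum_ne_top hσ y)).1 h
  have hKSP (x y : V) : P x y * θ y + P x y * η y = P x y := by
    rw [← mul_add, hθη, mul_one]
  have hKS (x : V) : ∑' y, (P x y * θ y + P x y * η y) = 1 := by
    simp only [hKSP, hPsum]
  have hK (y : V) : ∑' x, (μ x + σ x) * (P x y * θ y) = σ y := by
    simp only [← mul_assoc, hPmul]
    rw [ENNReal.tsum_mul_right, hcol, hθmul]
  have hS (y : V) : ∑' x, (μ x + σ x) * (P x y * η y) = ν y := by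
    simp only [← mul_assoc, hPmul]
    rw [ENNReal.tsum_mul_right, hcol, hηmul]
  have hrow' := tsum_stoppedLaw_row hKS hK hfin
  have hcol' := tsum_stoppedLaw_col_le hK hS
  refine ⟨stoppedLaw μ (fun x y => P x y * θ y) (fun x y => P x y * η y), hrow',
    fun y => ?_, ?_⟩
  · by_contra hne
    have htot : ∑' y, ∑' x,
        stoppedLaw μ (fun x y => P x y * θ y) (fun x y => P x y * η y) x y = 1 := by
      rw [ENNReal.tsum_comm]
      simp only [hrow', hμ]
    have hlt := ENNReal.tsum_lt_tsum (htot.trans_ne ENNReal.one_ne_top) hcol'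
      (lt_of_le_of_ne (hcol' y) hne)
    rw [htot, hν] at hlt
    exact lt_irrefl _ hlt
  · have h := tsum_stoppedLaw_mul_le hKS hK hc htri
    simpa only [hKSP, hPmul] using h

end StoppedChain

section Paths

variable {E : Set (V × V)} {w : V × V → ℝ}

theorem pathEdges_cons_cons (a b : V) (t : List V) :
    pathEdges (a :: b :: t) = (a, b) :: pathEdges (b :: t) := rfl

theorem pathEdges_singleton (a : V) : pathEdges [a] = [] := rfl

theorem fst_mem_of_mem_pathEdges {l : List V} {e : V × V} (h : e ∈ pathEdges l) : e.1 ∈ l :=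
  (List.of_mem_zip (a := e.1) (b := e.2) h).1

theorem mem_of_mem_pathEdges {l : List V} (hl : IsDipath E l) {e : V × V}
    (h : e ∈ pathEdges l) : e ∈ E := by
  obtain ⟨-, hc⟩ := hl
  induction l with
  | nil => simp [pathEdges] at h
  | cons a t ih =>
    cases t with
    | nil => simp [pathEdges] at h
    | cons b t =>
      replace hc := List.isChain_cons_cons.1 hc
      rw [pathEdges_cons_cons, List.mem_cons] at h
      rcases h with rfl | h
      · exact hc.1
      · exact ih h hc.2

theorem pathCost_cons_cons (a b : V) (t : List V) :
    pathCost w (a :: b :: t) = w (a, b) + pathCost w (b :: t) := by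
  simp [pathCost, pathEdges_cons_cons]

theorem pathCost_singleton (a : V) : pathCost w [a] = 0 := by
  simp [pathCost, pathEdges_singleton]

theorem pathCost_nonneg (hw : ∀ e, 0 ≤ w e) (l : List V) : 0 ≤ pathCost w l := by
  refine List.sum_nonneg fun x hx => ?_
  obtain ⟨e, -, rfl⟩ := List.mem_map.1 hx
  exact hw e

theorem pathCost_le_append (hw : ∀ e, 0 ≤ w e) (s t : List V) :
    pathCost w t ≤ pathCost w (s ++ t) := by
  induction s with
  | nil => rfl
  | cons a s ih =>
    refine ih.trans ?_
    rw [List.cons_append]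
    cases s ++ t with
    | nil => simp [pathCost, pathEdges]
    | cons b u =>
      rw [pathCost_cons_cons]
      exact le_add_of_nonneg_left (hw _)

theorem exists_nodup_dipath (hw : ∀ e, 0 ≤ w e) {l : List V} (hl : IsDipath E l) :
    ∃ l', IsDipath E l' ∧ l'.Nodup ∧ l'.head? = l.head? ∧ l'.getLast? = l.getLast? ∧
      pathCost w l' ≤ pathCost w l := by
  obtain ⟨hne, hc⟩ := hl
  induction l with
  | nil => exact absurd rfl hne
  | cons a t ih =>
    cases t with
    | nil => exact ⟨[a], ⟨hne, hc⟩, List.nodup_singleton a, rfl, rfl, le_rfl⟩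
    | cons b t =>
      have hc' := List.isChain_cons_cons.1 hc
      obtain ⟨l', ⟨hne', hch'⟩, hnd, hhd, hlast, hcost⟩ := ih (List.cons_ne_nil _ _) hc'.2
      have hmono : pathCost w (b :: t) ≤ pathCost w (a :: b :: t) :=
        pathCost_le_append hw [a] _
      by_cases ha : a ∈ l'
      · obtain ⟨s, u, rfl⟩ := List.append_of_mem ha
        refine ⟨a :: u, ⟨List.cons_ne_nil _ _, hch'.right_of_append⟩, hnd.of_append_right, rfl,
          ?_, (pathCost_le_append hw s _).trans (hcost.trans hmono)⟩
        rw [List.getLast?_cons_cons, ← hlast, List.getLast?_append_of_ne_nil _ (by simp)]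
      · cases l' with
        | nil => exact absurd rfl hne'
        | cons b' u =>
          obtain rfl : b' = b := by simpa using hhd
          refine ⟨a :: b' :: u, ⟨List.cons_ne_nil _ _, List.isChain_cons_cons.2 ⟨hc'.1, hch'⟩⟩,
            List.nodup_cons.2 ⟨ha, hnd⟩, rfl, ?_, ?_⟩
          · rw [List.getLast?_cons_cons, List.getLast?_cons_cons, hlast]
          · rw [pathCost_cons_cons, pathCost_cons_cons]
            gcongr

theorem exists_dipath {x y : V} (h : Relation.ReflTransGen (edgeRel E) x y) :
    ∃ l, IsDipath E l ∧ l.head? = some x ∧ l.getLast? = some y := by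
  induction h using Relation.ReflTransGen.head_induction_on with
  | refl => exact ⟨[y], ⟨List.cons_ne_nil _ _, List.isChain_singleton y⟩, rfl, rfl⟩
  | @head a b hab _ ih =>
    obtain ⟨l, ⟨hne, hc⟩, hhd, hlast⟩ := ih
    cases l with
    | nil => exact absurd rfl hne
    | cons b' t =>
      obtain rfl : b' = b := by simpa using hhd
      exact ⟨a :: b' :: t, ⟨List.cons_ne_nil _ _, List.isChain_cons_cons.2 ⟨hab, hc⟩⟩, rfl,
        by rw [List.getLast?_cons_cons, hlast]⟩

theorem geoCost_nonneg (hw : ∀ e, 0 ≤ w e) (x y : V) : 0 ≤ geoCost E w x y := by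
  refine Real.sInf_nonneg ?_
  rintro _ ⟨l, -, -, -, rfl⟩
  exact pathCost_nonneg hw l

theorem geoCost_le_pathCost (hw : ∀ e, 0 ≤ w e) {x y : V} {l : List V} (hl : IsDipath E l)
    (hx : l.head? = some x) (hy : l.getLast? = some y) : geoCost E w x y ≤ pathCost w l := by
  refine csInf_le ⟨0, ?_⟩ ⟨l, hl, hx, hy, rfl⟩
  rintro _ ⟨l, -, -, -, rfl⟩
  exact pathCost_nonneg hw l

theorem exists_nodup_pathCost_lt (hconn : ∀ x y : V, Relation.ReflTransGen (edgeRel E) x y)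
    (hw : ∀ e, 0 ≤ w e) (x y : V) {ε : ℝ} (hε : 0 < ε) :
    ∃ l, IsDipath E l ∧ l.Nodup ∧ l.head? = some x ∧ l.getLast? = some y ∧
      pathCost w l < geoCost E w x y + ε := by
  obtain ⟨l₀, h₀, hx₀, hy₀⟩ := exists_dipath (hconn x y)
  obtain ⟨_, ⟨l, hl, hx, hy, rfl⟩, hlt⟩ := exists_lt_of_csInf_lt
    (s := {r | ∃ l, IsDipath E l ∧ l.head? = some x ∧ l.getLast? = some y ∧ pathCost w l = r})
    ⟨_, l₀, h₀, hx₀, hy₀, rfl⟩ (lt_add_of_pos_right (geoCost E w x y) hε)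
  obtain ⟨l', hl', hnd, hx', hy', hle⟩ := exists_nodup_dipath hw hl
  exact ⟨l', hl', hnd, hx'.trans hx, hy'.trans hy, hle.trans_lt hlt⟩

theorem geoCost_self (hw : ∀ e, 0 ≤ w e) (x : V) : geoCost E w x x = 0 := by
  refine le_antisymm ?_ (geoCost_nonneg hw x x)
  have hx : IsDipath E [x] := ⟨List.cons_ne_nil _ _, List.isChain_singleton x⟩
  simpa [pathCost_singleton] using geoCost_le_pathCost hw hx rfl rfl

theorem geoCost_le_edge_add (hconn : ∀ x y : V, Relation.ReflTransGen (edgeRel E) x y)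
    (hw : ∀ e, 0 ≤ w e) {x y : V} (hxy : (x, y) ∈ E) (z : V) :
    geoCost E w x z ≤ w (x, y) + geoCost E w y z := by
  refine le_of_forall_pos_le_add fun ε hε => ?_
  obtain ⟨l, ⟨hne, hc⟩, -, hhd, hlast, hlt⟩ := exists_nodup_pathCost_lt hconn hw y z hε
  cases l with
  | nil => exact absurd rfl hne
  | cons y' t =>
    obtain rfl : y' = y := by simpa using hhd
    have h := geoCost_le_pathCost hw (x := x) (y := z) (l := x :: y' :: t)
      ⟨List.cons_ne_nil _ _, List.isChain_cons_cons.2 ⟨hxy, hc⟩⟩ rfl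
      (by rw [List.getLast?_cons_cons, hlast])
    rw [pathCost_cons_cons] at h
    linarith

theorem geoCost_le_pathCost_add (hconn : ∀ x y : V, Relation.ReflTransGen (edgeRel E) x y)
    (hw : ∀ e, 0 ≤ w e) {x y : V} (z : V) {l : List V} (hl : IsDipath E l)
    (hx : l.head? = some x) (hy : l.getLast? = some y) :
    geoCost E w x z ≤ pathCost w l + geoCost E w y z := by
  obtain ⟨hne, hc⟩ := hl
  induction l generalizing x with
  | nil => exact absurd rfl hne
  | cons a t ih =>
    obtain rfl : a = x := by simpa using hx
    cases t with
    | nil =>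
      obtain rfl : a = y := by simpa using hy
      simp [pathCost_singleton]
    | cons b t =>
      replace hc := List.isChain_cons_cons.1 hc
      have h1 := ih rfl (by rwa [List.getLast?_cons_cons] at hy) (List.cons_ne_nil _ _) hc.2
      have h2 := geoCost_le_edge_add hconn hw hc.1 z
      rw [pathCost_cons_cons]
      linarith

theorem geoCost_triangle (hconn : ∀ x y : V, Relation.ReflTransGen (edgeRel E) x y)
    (hw : ∀ e, 0 ≤ w e) (x y z : V) :
    geoCost E w x z ≤ geoCost E w x y + geoCost E w y z := by
  refine le_of_forall_pos_le_add fun ε hε => ?_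
  obtain ⟨l, hl, -, hhd, hlast, hlt⟩ := exists_nodup_pathCost_lt hconn hw x y hε
  have h := geoCost_le_pathCost_add hconn hw z hl hhd hlast
  linarith

end Paths

section PathFlow

open scoped Classical

variable {E : Set (V × V)} {w : V × V → ℝ}

theorem pathFlow_nonneg (l : List V) (e : V × V) : 0 ≤ pathFlow l e :=
  Set.indicator_nonneg (fun _ _ => zero_le_one) e

theorem pathFlow_le_one (l : List V) (e : V × V) : pathFlow l e ≤ 1 :=
  Set.indicator_le_self' (fun _ _ => zero_le_one) e

theorem ofReal_pathFlow_singleton (a : V) (e : V × V) : ENNReal.ofReal (pathFlow [a] e) = 0 := by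
  simp [pathFlow, pathEdges_singleton]

theorem ofReal_pathFlow_cons_cons {a b : V} {t : List V} (ha : a ∉ b :: t) (e : V × V) :
    ENNReal.ofReal (pathFlow (a :: b :: t) e) =
      (if e = (a, b) then 1 else 0) + ENNReal.ofReal (pathFlow (b :: t) e) := by
  by_cases he : e = (a, b)
  · have h : e ∉ pathEdges (b :: t) := fun h => ha (by
      have := fst_mem_of_mem_pathEdges h
      rwa [he] at this)
    rw [he] at h
    simp [pathFlow, Set.indicator, pathEdges_cons_cons, h, he]
  · simp [pathFlow, Set.indicator, pathEdges_cons_cons, he]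

theorem tsum_pathFlow_mul (hw : ∀ e, 0 ≤ w e) {l : List V} (hl : l ≠ []) (hnd : l.Nodup) :
    ∑' e, ENNReal.ofReal (pathFlow l e) * ENNReal.ofReal (w e) =
      ENNReal.ofReal (pathCost w l) := by
  induction l with
  | nil => exact absurd rfl hl
  | cons a t ih =>
    cases t with
    | nil => simp [ofReal_pathFlow_singleton, pathCost_singleton]
    | cons b t =>
      rw [List.nodup_cons] at hnd
      simp only [ofReal_pathFlow_cons_cons hnd.1, add_mul, ENNReal.tsum_add,
        ih (List.cons_ne_nil _ _) hnd.2, pathCost_cons_cons]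
      rw [ENNReal.ofReal_add (hw _) (pathCost_nonneg hw _)]
      simp

theorem tsum_pathFlow_out {l : List V} (hl : l ≠ []) (hnd : l.Nodup) (x : V) :
    ∑' y, ENNReal.ofReal (pathFlow l (x, y)) + (if l.getLast? = some x then 1 else 0) =
      if x ∈ l then 1 else 0 := by
  induction l with
  | nil => exact absurd rfl hl
  | cons a t ih =>
    cases t with
    | nil => simp [ofReal_pathFlow_singleton, eq_comm]
    | cons b t =>
      rw [List.nodup_cons] at hnd
      simp only [ofReal_pathFlow_cons_cons hnd.1, ENNReal.tsum_add, List.getLast?_cons_cons,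
        add_assoc, ih (List.cons_ne_nil _ _) hnd.2, Prod.mk.injEq]
      by_cases hx : x = a
      · subst hx
        simp [hnd.1]
      · simp [hx]

theorem tsum_pathFlow_in {l : List V} (hl : l ≠ []) (hnd : l.Nodup) (x : V) :
    ∑' y, ENNReal.ofReal (pathFlow l (y, x)) + (if l.head? = some x then 1 else 0) =
      if x ∈ l then 1 else 0 := by
  induction l with
  | nil => exact absurd rfl hl
  | cons a t ih =>
    cases t with
    | nil => simp [ofReal_pathFlow_singleton, eq_comm]
    | cons b t =>
      rw [List.nodup_cons] at hnd
      have ih' := ih (List.cons_ne_nil _ _) hnd.2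
      have h1 : ∑' y, (if (y, x) = (a, b) then (1 : ℝ≥0∞) else 0) = if b = x then 1 else 0 := by
        by_cases hx : b = x <;> simp [hx, eq_comm]
      simp only [List.head?_cons, Option.some.injEq] at ih' ⊢
      simp only [ofReal_pathFlow_cons_cons hnd.1, ENNReal.tsum_add, h1]
      rw [add_comm (ite _ _ _) (tsum _), ih']
      by_cases hx : x = a
      · subst hx
        rw [if_neg hnd.1]
        simp
      · simp [hx, Ne.symm hx]

end PathFlow

section Decomposition

open scoped Classical

variable {E : Set (V × V)} {w : V × V → ℝ} {ι : Type*} {γ : ι → List V} {q : ι → ℝ}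
  {Q : V × V → ℝ}

theorem summable_mul_pathFlow (hq : ∀ i, 0 ≤ q i) (hs : Summable q) (e : V × V) :
    Summable fun i => q i * pathFlow (γ i) e :=
  hs.of_nonneg_of_le (fun i => mul_nonneg (hq i) (pathFlow_nonneg _ _))
    fun i => mul_le_of_le_one_right (hq i) (pathFlow_le_one _ _)

theorem ofReal_tsum_mul_pathFlow (hq : ∀ i, 0 ≤ q i) (hs : Summable q)
    (hQ : ∀ e, Q e = ∑' i, q i * pathFlow (γ i) e) (e : V × V) :
    ENNReal.ofReal (Q e) = ∑' i, ENNReal.ofReal (q i) * ENNReal.ofReal (pathFlow (γ i) e) := by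
  rw [hQ, ENNReal.ofReal_tsum_of_nonneg
    (fun i => mul_nonneg (hq i) (pathFlow_nonneg _ _)) (summable_mul_pathFlow hq hs e)]
  exact tsum_congr fun i => ENNReal.ofReal_mul (hq i)

theorem isFlow_of_decomposition (hγ : ∀ i, IsDipath E (γ i)) (hq : ∀ i, 0 ≤ q i)
    (hQ : ∀ e, Q e = ∑' i, q i * pathFlow (γ i) e) : IsFlow E Q := by
  refine ⟨fun e => ?_, fun e he => ?_⟩
  · rw [hQ]
    exact tsum_nonneg fun i => mul_nonneg (hq i) (pathFlow_nonneg _ _)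
  · have h (i : ι) : q i * pathFlow (γ i) e = 0 := by
      rw [pathFlow, Set.indicator_of_notMem, mul_zero]
      exact fun h => he (mem_of_mem_pathEdges (hγ i) h)
    rw [hQ, tsum_congr h, tsum_zero]

theorem tsum_decomposition_mul (hw : ∀ e, 0 ≤ w e) (hγ : ∀ i, IsDipath E (γ i))
    (hnd : ∀ i, (γ i).Nodup) (hq : ∀ i, 0 ≤ q i) (hs : Summable q)
    (hQ : ∀ e, Q e = ∑' i, q i * pathFlow (γ i) e) :
    ∑' e, ENNReal.ofReal (Q e * w e) =
      ∑' i, ENNReal.ofReal (q i) * ENNReal.ofReal (pathCost w (γ i)) := by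
  simp only [ENNReal.ofReal_mul' (hw _), ofReal_tsum_mul_pathFlow hq hs hQ,
    ← ENNReal.tsum_mul_right]
  rw [ENNReal.tsum_comm]
  refine tsum_congr fun i => ?_
  simp only [mul_assoc]
  rw [ENNReal.tsum_mul_left, tsum_pathFlow_mul hw (hγ i).1 (hnd i)]

theorem tsum_decomposition_out (hγ : ∀ i, IsDipath E (γ i))
    (hnd : ∀ i, (γ i).Nodup) (hq : ∀ i, 0 ≤ q i) (hs : Summable q)
    (hQ : ∀ e, Q e = ∑' i, q i * pathFlow (γ i) e) (x : V) :
    ∑' y, ENNReal.ofReal (Q (x, y)) +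
        ∑' i, ENNReal.ofReal (q i) * (if (γ i).getLast? = some x then 1 else 0) =
      ∑' i, ENNReal.ofReal (q i) * (if x ∈ γ i then 1 else 0) := by
  simp only [ofReal_tsum_mul_pathFlow hq hs hQ]
  rw [ENNReal.tsum_comm, ← ENNReal.tsum_add]
  refine tsum_congr fun i => ?_
  rw [ENNReal.tsum_mul_left, ← mul_add, tsum_pathFlow_out (hγ i).1 (hnd i)]

theorem tsum_decomposition_in (hγ : ∀ i, IsDipath E (γ i))
    (hnd : ∀ i, (γ i).Nodup) (hq : ∀ i, 0 ≤ q i) (hs : Summable q)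
    (hQ : ∀ e, Q e = ∑' i, q i * pathFlow (γ i) e) (x : V) :
    ∑' y, ENNReal.ofReal (Q (y, x)) +
        ∑' i, ENNReal.ofReal (q i) * (if (γ i).head? = some x then 1 else 0) =
      ∑' i, ENNReal.ofReal (q i) * (if x ∈ γ i then 1 else 0) := by
  simp only [ofReal_tsum_mul_pathFlow hq hs hQ]
  rw [ENNReal.tsum_comm, ← ENNReal.tsum_add]
  refine tsum_congr fun i => ?_
  rw [ENNReal.tsum_mul_left, ← mul_add, tsum_pathFlow_in (hγ i).1 (hnd i)]

theorem tsum_ofReal_mul_ite_ne_top (hs : Summable q) (p : ι → Prop) [DecidablePred p] :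
    ∑' i, ENNReal.ofReal (q i) * (if p i then 1 else 0) ≠ ⊤ := by
  refine ne_top_of_le_ne_top hs.tsum_ofReal_ne_top (ENNReal.tsum_le_tsum fun i => ?_)
  split_ifs <;> simp

theorem divergence_eq_sub_iff (hQ : ∀ e, 0 ≤ Q e) {x : V} {a b : ℝ} (ha : 0 ≤ a) (hb : 0 ≤ b)
    (hout : ∑' y, ENNReal.ofReal (Q (x, y)) ≠ ⊤) (hin : ∑' y, ENNReal.ofReal (Q (y, x)) ≠ ⊤) :
    divergence Q x = a - b ↔
      ∑' y, ENNReal.ofReal (Q (x, y)) + ENNReal.ofReal b =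
        ∑' y, ENNReal.ofReal (Q (y, x)) + ENNReal.ofReal a := by
  rw [← ENNReal.toReal_eq_toReal_iff' (by finiteness) (by finiteness),
    ENNReal.toReal_add hout (by finiteness), ENNReal.toReal_add hin (by finiteness),
    ENNReal.toReal_ofReal ha, ENNReal.toReal_ofReal hb,
    ENNReal.tsum_toReal_eq (fun _ => ENNReal.ofReal_ne_top),
    ENNReal.tsum_toReal_eq (fun _ => ENNReal.ofReal_ne_top)]
  simp only [ENNReal.toReal_ofReal (hQ _), divergence]
  constructor <;> intro h <;> linarith

/-- The divergence of a decomposed flow is determined by the endpoints of its paths. -/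
theorem divergence_decomposition_iff (hγ : ∀ i, IsDipath E (γ i))
    (hnd : ∀ i, (γ i).Nodup) (hq : ∀ i, 0 ≤ q i) (hs : Summable q)
    (hQ : ∀ e, Q e = ∑' i, q i * pathFlow (γ i) e) {x : V} {a b : ℝ} (ha : 0 ≤ a) (hb : 0 ≤ b) :
    divergence Q x = a - b ↔
      ∑' i, ENNReal.ofReal (q i) * (if (γ i).head? = some x then 1 else 0) + ENNReal.ofReal b =
        ∑' i, ENNReal.ofReal (q i) * (if (γ i).getLast? = some x then 1 else 0) +
          ENNReal.ofReal a := by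
  have ho := tsum_decomposition_out hγ hnd hq hs hQ x
  have hi := tsum_decomposition_in hγ hnd hq hs hQ x
  have hfin := tsum_ofReal_mul_ite_ne_top hs (fun i => x ∈ γ i)
  have hout := ne_top_of_le_ne_top hfin (le_self_add.trans_eq ho)
  have hin := ne_top_of_le_ne_top hfin (le_self_add.trans_eq hi)
  have hh := tsum_ofReal_mul_ite_ne_top hs (fun i => (γ i).head? = some x)
  have hl := tsum_ofReal_mul_ite_ne_top hs (fun i => (γ i).getLast? = some x)
  rw [divergence_eq_sub_iff (isFlow_of_decomposition hγ hq hQ).1 ha hb hout hin]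
  have hoi := ho.trans hi.symm
  rw [← ENNReal.toReal_eq_toReal_iff' (by finiteness) (by finiteness),
    ENNReal.toReal_add hout hl, ENNReal.toReal_add hin hh] at hoi
  rw [← ENNReal.toReal_eq_toReal_iff' (by finiteness) (by finiteness),
    ← ENNReal.toReal_eq_toReal_iff' (by finiteness) (by finiteness),
    ENNReal.toReal_add hout (by finiteness), ENNReal.toReal_add hin (by finiteness),
    ENNReal.toReal_add hh (by finiteness), ENNReal.toReal_add hl (by finiteness)]
  constructor <;> intro h <;> linarith

theorem finDecomposable_of_countable [Countable ι] [Nonempty V] (hγ : ∀ i, IsDipath E (γ i))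
    (hnd : ∀ i, (γ i).Nodup) (hq : ∀ i, 0 ≤ q i) (hs : Summable q)
    (hQ : ∀ e, Q e = ∑' i, q i * pathFlow (γ i) e) : FinDecomposable E Q := by
  obtain ⟨f, hf⟩ := exists_injective_nat ι
  obtain ⟨x₀⟩ := ‹Nonempty V›
  have hext {p : List V → Prop} (h : ∀ i, p (γ i)) (h₀ : p [x₀]) (n : ℕ) :
      p (Function.extend f γ (fun _ => [x₀]) n) := by
    by_cases hn : ∃ i, f i = n
    · obtain ⟨i, rfl⟩ := hn
      rw [hf.extend_apply]
      exact h i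
    · rwa [Function.extend_apply' _ _ _ hn]
  refine ⟨Function.extend f γ fun _ => [x₀], Function.extend f q 0,
    hext (p := IsDipath E) hγ ⟨List.cons_ne_nil _ _, List.isChain_singleton _⟩,
    hext hnd (List.nodup_singleton x₀), fun n => ?_, (summable_extend_zero hf).2 hs,
    fun e => ?_⟩
  · by_cases hn : ∃ i, f i = n
    · obtain ⟨i, rfl⟩ := hn
      rw [hf.extend_apply]
      exact hq i
    · rw [Function.extend_apply' _ _ _ hn, Pi.zero_apply]
  · rw [hQ, ← tsum_extend_zero hf]
    refine tsum_congr fun n => ?_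
    by_cases hn : ∃ i, f i = n
    · obtain ⟨i, rfl⟩ := hn
      simp only [hf.extend_apply]
    · simp only [Function.extend_apply' _ _ _ hn, Pi.zero_apply, zero_mul]

end Decomposition

section Comparison

open scoped Classical

variable {E : Set (V × V)} {w : V × V → ℝ} {μ₁ μ₂ : V → ℝ}

theorem IsProb.tsum_ofReal {μ : V → ℝ} (h : IsProb μ) : ∑' x, ENNReal.ofReal (μ x) = 1 := by
  rw [← ENNReal.ofReal_tsum_of_nonneg h.1 h.2.summable, h.2.tsum_eq, ENNReal.ofReal_one]

theorem isCoupling_toReal (h₁ : IsProb μ₁) (h₂ : IsProb μ₂) {ρ : V → V → ℝ≥0∞}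
    (hrow : ∀ x, ∑' y, ρ x y = ENNReal.ofReal (μ₁ x))
    (hcol : ∀ y, ∑' x, ρ x y = ENNReal.ofReal (μ₂ y)) :
    IsCoupling μ₁ μ₂ fun p => (ρ p.1 p.2).toReal := by
  refine ⟨fun p => ENNReal.toReal_nonneg, fun x => ?_, fun y => ?_⟩
  · have h := ENNReal.hasSum_toReal ((hrow x).trans_ne ENNReal.ofReal_ne_top)
    rwa [← ENNReal.tsum_toReal_eq (ENNReal.ne_top_of_tsum_ne_top
      ((hrow x).trans_ne ENNReal.ofReal_ne_top)), hrow, ENNReal.toReal_ofReal (h₁.1 x)] at h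
  · have h := ENNReal.hasSum_toReal ((hcol y).trans_ne ENNReal.ofReal_ne_top)
    rwa [← ENNReal.tsum_toReal_eq (ENNReal.ne_top_of_tsum_ne_top
      ((hcol y).trans_ne ENNReal.ofReal_ne_top)), hcol, ENNReal.toReal_ofReal (h₂.1 y)] at h

theorem IsCoupling.tsum_ofReal_row {ρ : V × V → ℝ} (h : IsCoupling μ₁ μ₂ ρ) (x : V) :
    ∑' y, ENNReal.ofReal (ρ (x, y)) = ENNReal.ofReal (μ₁ x) := by
  rw [← ENNReal.ofReal_tsum_of_nonneg (fun y => h.1 _) (h.2.1 x).summable, (h.2.1 x).tsum_eq]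

theorem IsCoupling.tsum_ofReal_col {ρ : V × V → ℝ} (h : IsCoupling μ₁ μ₂ ρ) (y : V) :
    ∑' x, ENNReal.ofReal (ρ (x, y)) = ENNReal.ofReal (μ₂ y) := by
  rw [← ENNReal.ofReal_tsum_of_nonneg (fun x => h.1 _) (h.2.2 y).summable, (h.2.2 y).tsum_eq]

theorem IsCoupling.tsum_ofReal (h₁ : IsProb μ₁) {ρ : V × V → ℝ} (h : IsCoupling μ₁ μ₂ ρ) :
    ∑' p, ENNReal.ofReal (ρ p) = 1 := by
  rw [ENNReal.tsum_prod']
  simp only [h.tsum_ofReal_row, h₁.tsum_ofReal]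

theorem exists_flow_le_of_coupling [Countable V]
    (hconn : ∀ x y : V, Relation.ReflTransGen (edgeRel E) x y) (hw : ∀ e, 0 ≤ w e)
    (h₁ : IsProb μ₁) (h₂ : IsProb μ₂) {ρ : V × V → ℝ} (hρ : IsCoupling μ₁ μ₂ ρ)
    {ε : ℝ} (hε : 0 < ε) :
    ∃ Q, (IsFlow E Q ∧ FinDecomposable E Q ∧ ∀ x, divergence Q x = μ₁ x - μ₂ x) ∧
      ∑' e, ENNReal.ofReal (Q e * w e) ≤
        ∑' p, ENNReal.ofReal (geoCost E w p.1 p.2 * ρ p) + ENNReal.ofReal ε := by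
  have hsum := hρ.tsum_ofReal h₁
  have hne : Nonempty V := by
    by_contra hV
    rw [not_nonempty_iff] at hV
    simpa using h₁.tsum_ofReal
  choose γ hγ hnd hhd hlast hlt using
    fun p : V × V => exists_nodup_pathCost_lt hconn hw p.1 p.2 hε
  have hs : Summable ρ := by
    have h := ENNReal.summable_toReal (hsum.trans_ne ENNReal.one_ne_top)
    simpa only [ENNReal.toReal_ofReal (hρ.1 _)] using h
  refine ⟨fun e => ∑' p, ρ p * pathFlow (γ p) e,
    ⟨isFlow_of_decomposition hγ hρ.1 fun _ => rfl,
      finDecomposable_of_countable hγ hnd hρ.1 hs fun _ => rfl, fun x => ?_⟩, ?_⟩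
  · rw [divergence_decomposition_iff hγ hnd hρ.1 hs (fun _ => rfl) (h₁.1 x) (h₂.1 x)]
    simp only [hhd, hlast, Option.some.injEq, mul_ite, mul_one, mul_zero]
    have hfst : ∑' p : V × V, (if p.1 = x then ENNReal.ofReal (ρ p) else 0) =
        ENNReal.ofReal (μ₁ x) := by
      rw [ENNReal.tsum_prod', tsum_eq_single x (fun y hy => by simp [hy])]
      simp [hρ.tsum_ofReal_row]
    have hsnd : ∑' p : V × V, (if p.2 = x then ENNReal.ofReal (ρ p) else 0) =
        ENNReal.ofReal (μ₂ x) := by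
      rw [ENNReal.tsum_prod']
      simp [hρ.tsum_ofReal_col]
    rw [hfst, hsnd, add_comm]
  · rw [tsum_decomposition_mul hw hγ hnd hρ.1 hs fun _ => rfl]
    calc ∑' p, ENNReal.ofReal (ρ p) * ENNReal.ofReal (pathCost w (γ p))
        ≤ ∑' p : V × V, (ENNReal.ofReal (geoCost E w p.1 p.2 * ρ p) +
            ENNReal.ofReal (ρ p) * ENNReal.ofReal ε) := by
          gcongr with p
          rw [mul_comm (geoCost E w p.1 p.2), ENNReal.ofReal_mul (hρ.1 p), ← mul_add,
            ← ENNReal.ofReal_add (geoCost_nonneg hw _ _) hε.le]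
          gcongr
          exact (hlt p).le
      _ = _ := by rw [ENNReal.tsum_add, ENNReal.tsum_mul_right, hsum, one_mul]

theorem exists_coupling_le_of_flow
    (hconn : ∀ x y : V, Relation.ReflTransGen (edgeRel E) x y) (hw : ∀ e, 0 ≤ w e)
    (h₁ : IsProb μ₁) (h₂ : IsProb μ₂) {Q : V × V → ℝ} (hQ : FinDecomposable E Q)
    (hdiv : ∀ x, divergence Q x = μ₁ x - μ₂ x) :
    ∃ ρ, IsCoupling μ₁ μ₂ ρ ∧ ∑' p, ENNReal.ofReal (geoCost E w p.1 p.2 * ρ p) ≤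
      ∑' e, ENNReal.ofReal (Q e * w e) := by
  obtain ⟨γ, q, hγ, hnd, hq, hs, hQ⟩ := hQ
  have hbal (x : V) := (divergence_decomposition_iff hγ hnd hq hs hQ (h₁.1 x) (h₂.1 x)).1 (hdiv x)
  have hhd (n : ℕ) : ∃ x, (γ n).head? = some x :=
    ⟨_, List.head?_eq_some_head (hγ n).1⟩
  have hlast (n : ℕ) : ∃ x, (γ n).getLast? = some x :=
    ⟨_, List.getLast?_eq_some_getLast (hγ n).1⟩
  choose a ha using hhd
  choose b hb using hlast
  simp only [ha, hb, Option.some.injEq] at hbal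
  set σ : V → ℝ≥0∞ := fun y => ∑' n, ENNReal.ofReal (q n) * (if b n = y then 1 else 0) with hσ
  set π : V → V → ℝ≥0∞ := fun x y =>
    (∑' n, ENNReal.ofReal (q n) * ((if a n = x then 1 else 0) * (if b n = y then 1 else 0))) +
      (if x = y then ENNReal.ofReal (μ₂ y) else 0) with hπ
  have hσfin : ∑' y, σ y ≠ ⊤ := by
    rw [hσ, ENNReal.tsum_comm]
    have h (n : ℕ) : ∑' y, (if b n = y then (1 : ℝ≥0∞) else 0) = 1 := by simp
    simpa only [ENNReal.tsum_mul_left, h, mul_one] using hs.tsum_ofReal_ne_top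
  have hrow (x : V) : ∑' y, π x y = ENNReal.ofReal (μ₁ x) + σ x := by
    simp only [hπ]
    rw [ENNReal.tsum_add, ENNReal.tsum_comm]
    simp only [ENNReal.tsum_mul_left]
    have h (n : ℕ) : ∑' y, (if b n = y then (1 : ℝ≥0∞) else 0) = 1 := by simp
    have h' : ∑' y, (if x = y then ENNReal.ofReal (μ₂ y) else 0) = ENNReal.ofReal (μ₂ x) := by
      simp
    simp only [h, h', mul_one]
    rw [hbal x, add_comm]
  have hcol (y : V) : ∑' x, π x y = ENNReal.ofReal (μ₂ y) + σ y := by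
    simp only [hπ]
    rw [ENNReal.tsum_add, ENNReal.tsum_comm]
    simp only [ENNReal.tsum_mul_left, ENNReal.tsum_mul_right]
    have h (n : ℕ) : ∑' x, (if a n = x then (1 : ℝ≥0∞) else 0) = 1 := by simp
    simp only [h, tsum_ite_eq, one_mul]
    rw [add_comm]
  obtain ⟨ρ, hρrow, hρcol, hρcost⟩ := exists_coupling_of_common_part
    (c := fun x y => ENNReal.ofReal (geoCost E w x y))
    h₁.tsum_ofReal h₂.tsum_ofReal hσfin hrow hcol
    (fun x => by rw [geoCost_self hw, ENNReal.ofReal_zero])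
    (fun x y z => by
      rw [← ENNReal.ofReal_add (geoCost_nonneg hw _ _) (geoCost_nonneg hw _ _)]
      exact ENNReal.ofReal_le_ofReal (geoCost_triangle hconn hw x y z))
  refine ⟨_, isCoupling_toReal h₁ h₂ hρrow hρcol, ?_⟩
  have hfin (x y : V) : ρ x y ≠ ⊤ :=
    ENNReal.ne_top_of_tsum_ne_top ((hρrow x).trans_ne ENNReal.ofReal_ne_top) y
  calc ∑' p : V × V, ENNReal.ofReal (geoCost E w p.1 p.2 * (ρ p.1 p.2).toReal)
      = ∑' x, ∑' y, ρ x y * ENNReal.ofReal (geoCost E w x y) := by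
        rw [ENNReal.tsum_prod']
        refine tsum_congr fun x => tsum_congr fun y => ?_
        rw [ENNReal.ofReal_mul (geoCost_nonneg hw _ _), ENNReal.ofReal_toReal (hfin x y), mul_comm]
    _ ≤ ∑' x, ∑' y, π x y * ENNReal.ofReal (geoCost E w x y) := hρcost
    _ = ∑' x, ∑' y, ∑' n, ENNReal.ofReal (q n) *
          ((if a n = x then 1 else 0) * ((if b n = y then 1 else 0) *
            ENNReal.ofReal (geoCost E w x y))) := by
        refine tsum_congr fun x => tsum_congr fun y => ?_
        simp only [hπ, add_mul, ← ENNReal.tsum_mul_right, mul_assoc]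
        split_ifs with h
        · rw [h, geoCost_self hw, ENNReal.ofReal_zero, mul_zero, add_zero]
        · rw [zero_mul, add_zero]
    _ = ∑' n, ENNReal.ofReal (q n) * ENNReal.ofReal (geoCost E w (a n) (b n)) := by
        simp only [ENNReal.tsum_comm (α := V) (β := ℕ), ENNReal.tsum_mul_left]
        simp
    _ ≤ ∑' n, ENNReal.ofReal (q n) * ENNReal.ofReal (pathCost w (γ n)) := by
        gcongr with n
        exact geoCost_le_pathCost hw (hγ n) (ha n) (hb n)
    _ = _ := (tsum_decomposition_mul hw hγ hnd hq hs hQ).symm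

end Comparison

/-- **Monge–Kantorovich problem = Beckmann minimal-flow problem for geodesic costs.**
On a connected weighted digraph with geodesic cost `c`, the infimum of `E_ρ(c)` over
couplings of `μ₁, μ₂` equals the infimum of `⟨Q, w⟩` over finitely decomposable flows
with `div Q = μ₁ - μ₂`. -/
theorem monge_kantorovich_eq_beckmann {V : Type*} [Countable V]
    (E : Set (V × V)) (hloop : ∀ x : V, (x, x) ∉ E)
    (hconn : ∀ x y : V, Relation.ReflTransGen (edgeRel E) x y)
    (w : V × V → ℝ) (hw : ∀ e, 0 ≤ w e)
    (μ₁ μ₂ : V → ℝ) (h₁ : IsProb μ₁) (h₂ : IsProb μ₂) :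
    (⨅ ρ ∈ {ρ : V × V → ℝ | IsCoupling μ₁ μ₂ ρ},
        ∑' p : V × V, ENNReal.ofReal (geoCost E w p.1 p.2 * ρ p)) =
      ⨅ Q ∈ {Q : V × V → ℝ | IsFlow E Q ∧ FinDecomposable E Q ∧
          ∀ x, divergence Q x = μ₁ x - μ₂ x},
        ∑' e : V × V, ENNReal.ofReal (Q e * w e) := by
  refine le_antisymm ?_ ?_
  · refine le_iInf₂ fun Q hQ => ?_
    obtain ⟨ρ, hρ, hle⟩ := exists_coupling_le_of_flow hconn hw h₁ h₂ hQ.2.1 hQ.2.2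
    exact (iInf₂_le ρ hρ).trans hle
  · refine le_iInf₂ fun ρ hρ => ENNReal.le_of_forall_pos_le_add fun ε hε _ => ?_
    obtain ⟨Q, hQ, hle⟩ := exists_flow_le_of_coupling hconn hw h₁ h₂ hρ
      (NNReal.coe_pos.2 hε)
    rw [ENNReal.ofReal_coe_nnreal] at hle
    exact (iInf₂_le Q hQ).trans hle
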